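/- For arbitrary CMIs K and K' on {1,…,n} (not necessarily in pure form): K ∼ K' if and only if can(pur(K)) = can(pur(K')) (equality of CMIs: same conditioning set and equal multisets, except that all degenerate canonical forms (·,⟨⟩) are identified). -/

import Mathlib

open scoped Classical

namespace Paper

variable {n : ℕ}

/-- The marginal distribution of the coordinates in `α` of a joint distribution `p` of
the discrete random variables `X_1, …, X_n` (each taking countably many values, coded
as natural numbers). -/
noncomputable def marginal (p : PMF (Fin n → ℕ)) (α : Finset (Fin n)) :
    PMF ({ i // i ∈ α } → ℕ) :=
  p.map fun x i => x i.1

/-- The Shannon (joint) entropy `H(X_α)`. -/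
noncomputable def Hm (p : PMF (Fin n → ℕ)) (α : Finset (Fin n)) : ℝ :=
  ∑' y, Real.negMulLog ((marginal p α) y).toReal

/-- The conditional entropy `H(X_β | X_α) = H(X_{β ∪ α}) - H(X_α)`. -/
noncomputable def Hc (p : PMF (Fin n → ℕ)) (β α : Finset (Fin n)) : ℝ :=
  Hm p (β ∪ α) - Hm p α

/-- Every individual random variable `X_i` has finite Shannon entropy
(the series defining `H(X_i)` is summable). -/
def FiniteEntropy (p : PMF (Fin n → ℕ)) : Prop :=
  ∀ i : Fin n, Summable fun y : ℕ => Real.negMulLog ((p.map fun x => x i) y).toReal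

/-- `J(X_{Q_1}, …, X_{Q_k} | X_C) = (∑ i, H(X_{Q_i}|X_C)) - H(X_{Q_1},…,X_{Q_k}|X_C)`;
the joint conditional entropy of the tuple `(X_{Q_1},…,X_{Q_k})` equals
`H(X_{∪ i, Q_i} | X_C)` since the two tuples determine each other. -/
noncomputable def J (p : PMF (Fin n → ℕ)) (C : Finset (Fin n))
    (Qs : Multiset (Finset (Fin n))) : ℝ :=
  (Qs.map fun Q => Hc p Q C).sum - Hc p Qs.sup C

/-- A conditional mutual independency (CMI) on `{1, …, n}`: a conditioning set `C`
together with a finite multiset `⟨Q_1, …, Q_k⟩` of subsets of `{1, …, n}`. -/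
structure CMI (n : ℕ) where
  C : Finset (Fin n)
  Qs : Multiset (Finset (Fin n))

/-- `K` is valid for the joint distribution `p`. -/
def Valid (p : PMF (Fin n → ℕ)) (K : CMI n) : Prop :=
  J p K.C K.Qs = 0

/-- `K` is degenerate: valid for every finite-entropy joint distribution. -/
def Degenerate (K : CMI n) : Prop :=
  ∀ p : PMF (Fin n → ℕ), FiniteEntropy p → Valid p K

/-- `K ∼ K'`: valid for exactly the same finite-entropy joint distributions. -/
def Equivalent (K K' : CMI n) : Prop :=
  ∀ p : PMF (Fin n → ℕ), FiniteEntropy p → (Valid p K ↔ Valid p K')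

/-- `K` implies `K'`. -/
def Implies (K K' : CMI n) : Prop :=
  ∀ p : PMF (Fin n → ℕ), FiniteEntropy p → Valid p K → Valid p K'

/-- `K` is in pure form: every `Q_i` is nonempty and disjoint from `C`. -/
def IsPure (K : CMI n) : Prop :=
  ∀ Q ∈ K.Qs, Q ≠ ∅ ∧ Q ∩ K.C = ∅

/-- The pure form `pur(K) = (C, ⟨Q_i \ C : Q_i \ C ≠ ∅⟩)`. -/
noncomputable def pur (K : CMI n) : CMI n :=
  ⟨K.C, (K.Qs.map fun Q => Q \ K.C).filter fun Q => Q ≠ ∅⟩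

/-- The set `𝕀_K` of repeated indices of `K`: indices lying in `Q_i ∩ Q_j` for two
distinct entries `i ≠ j` of the multiset (automatically `∅` when `k ≤ 1`). -/
noncomputable def repSet (K : CMI n) : Finset (Fin n) :=
  Finset.univ.filter fun q => 2 ≤ Multiset.card (K.Qs.filter fun Q => q ∈ Q)

/-- The multiset `⟨P_1, …, P_t⟩` of nonempty sets among the `Q_i \ 𝕀_K`. -/
noncomputable def parts (K : CMI n) : Multiset (Finset (Fin n)) :=
  (K.Qs.map fun Q => Q \ repSet K).filter fun P => P ≠ ∅

/-- The multiset of the `P_j`-entries of the canonical form `can(K)`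
(general notation). -/
noncomputable def canParts (K : CMI n) : Multiset (Finset (Fin n)) :=
  if Multiset.card K.Qs ≤ 1 then 0
  else if repSet K ≠ ∅ ∧ Multiset.card (parts K) ≤ 1 then 0
  else parts K

/-- The canonical form `can(K)` (of a pure-form CMI); all degenerate canonical forms
`(·,⟨⟩)` are represented by `⟨∅, 0⟩`. -/
noncomputable def can (K : CMI n) : CMI n :=
  if Multiset.card K.Qs ≤ 1 then ⟨∅, 0⟩
  else if repSet K = ∅ then ⟨K.C, parts K⟩
  else if Multiset.card (parts K) ≤ 1 then ⟨K.C, {repSet K, repSet K}⟩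
  else ⟨K.C, repSet K ::ₘ repSet K ::ₘ parts K⟩

/-- `R_K^{K'}`: the CMI "`K'` conditioning on `K`"; the degenerate case `(·,⟨⟩)` is
represented by `⟨∅, 0⟩`. -/
noncomputable def RCond (K K' : CMI n) : CMI n :=
  let I := repSet (pur K)
  let I' := repSet (pur K')
  let Ts := ((canParts (pur K')).map fun P => P \ I).filter fun T => T ≠ ∅
  if I' \ I = ∅ ∧ Multiset.card Ts ≤ 1 then ⟨∅, 0⟩
  else if I' \ I = ∅ then ⟨K'.C \ I, Ts⟩
  else if Multiset.card Ts ≤ 1 then ⟨K'.C \ I, {I' \ I, I' \ I}⟩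
  else ⟨K'.C \ I, (I' \ I) ::ₘ (I' \ I) ::ₘ Ts⟩



/-! ### Entropy in extended nonnegative reals -/

noncomputable def ent {Z : Type*} (q : PMF Z) : ENNReal :=
  ∑' z, ENNReal.ofReal (Real.negMulLog (q z).toReal)

lemma toReal_le_one {Z : Type*} (q : PMF Z) (z : Z) : (q z).toReal ≤ 1 := by
  have := ENNReal.toReal_mono ENNReal.one_ne_top (q.coe_le_one z)
  simpa using this

lemma nml_nonneg {Z : Type*} (q : PMF Z) (z : Z) : 0 ≤ Real.negMulLog (q z).toReal :=
  Real.negMulLog_nonneg ENNReal.toReal_nonneg (toReal_le_one q z)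

lemma ofReal_nml {Z : Type*} (q : PMF Z) (z : Z) :
    ENNReal.ofReal (Real.negMulLog (q z).toReal)
      = q z * ENNReal.ofReal (-Real.log (q z).toReal) := by
  have : Real.negMulLog (q z).toReal = (q z).toReal * (-Real.log (q z).toReal) := by
    unfold Real.negMulLog; ring
  rw [this, ENNReal.ofReal_mul ENNReal.toReal_nonneg, ENNReal.ofReal_toReal (q.apply_ne_top z)]

lemma tsum_map {Z U : Type*} (q : PMF Z) (g : Z → U) (F : U → ENNReal) :
    ∑' u, (q.map g) u * F u = ∑' z, q z * F (g z) := by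
  simp only [PMF.map_apply, ← ENNReal.tsum_mul_right]
  rw [ENNReal.tsum_comm]
  refine tsum_congr fun z => ?_
  rw [tsum_eq_single (g z)]
  · simp
  · intro u hu
    simp [hu]

lemma ent_map_eq {Z U : Type*} (q : PMF Z) (g : Z → U) :
    ent (q.map g) = ∑' z, q z * ENNReal.ofReal (-Real.log ((q.map g) (g z)).toReal) := by
  unfold ent
  simp only [ofReal_nml]
  exact tsum_map q g (fun u => ENNReal.ofReal (-Real.log ((q.map g) u).toReal))

lemma ent_eq {Z : Type*} (q : PMF Z) :
    ent q = ∑' z, q z * ENNReal.ofReal (-Real.log (q z).toReal) := by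
  unfold ent
  simp only [ofReal_nml]

lemma le_map {Z U : Type*} (q : PMF Z) (g : Z → U) (z : Z) : q z ≤ (q.map g) (g z) := by
  rw [PMF.map_apply]
  refine le_trans ?_ (ENNReal.le_tsum z)
  simp

lemma ent_mono {Z U : Type*} (q : PMF Z) (g : Z → U) : ent (q.map g) ≤ ent q := by
  rw [ent_map_eq, ent_eq]
  refine ENNReal.tsum_le_tsum fun z => ?_
  by_cases h : q z = 0
  · simp [h]
  gcongr
  · exact ENNReal.toReal_pos h (q.apply_ne_top z)
  · exact (q.map g).apply_ne_top _
  · exact le_map q g z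

lemma ratio_sum {Z U V W : Type*} (q : PMF Z) (a : Z → U) (b : Z → V) (c : U → W) (d : V → W)
    (h : ∀ z, c (a z) = d (b z)) (hinj : Function.Injective fun z => (a z, b z)) :
    ∑' z, (q.map a) (a z) * ((q.map b) (b z) * ((q.map (c ∘ a)) (c (a z)))⁻¹) ≤ 1 := by
  have hW : ∀ w, (q.map (c ∘ a)) w = ∑' v, if w = d v then (q.map b) v else 0 := by
    intro w
    have : c ∘ a = d ∘ b := funext h
    rw [this, ← PMF.map_comp, PMF.map_apply]
  calc ∑' z, (q.map a) (a z) * ((q.map b) (b z) * ((q.map (c ∘ a)) (c (a z)))⁻¹)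
      = ∑' z, (fun uv : U × V => (q.map a) uv.1 *
          ((if c uv.1 = d uv.2 then (q.map b) uv.2 else 0) *
            ((q.map (c ∘ a)) (c uv.1))⁻¹)) ((fun z => (a z, b z)) z) := by
        refine tsum_congr fun z => ?_
        simp [h z]
    _ ≤ ∑' uv : U × V, (q.map a) uv.1 *
          ((if c uv.1 = d uv.2 then (q.map b) uv.2 else 0) *
            ((q.map (c ∘ a)) (c uv.1))⁻¹) := ENNReal.tsum_comp_le_tsum_of_injective hinj _
    _ = ∑' u, ∑' v, (q.map a) u *
          ((if c u = d v then (q.map b) v else 0) * ((q.map (c ∘ a)) (c u))⁻¹) :=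
        ENNReal.tsum_prod
          (f := fun u v => (q.map a) u *
          ((if c u = d v then (q.map b) v else 0) * ((q.map (c ∘ a)) (c u))⁻¹))
    _ ≤ ∑' u, (q.map a) u := by
        refine ENNReal.tsum_le_tsum fun u => ?_
        rw [ENNReal.tsum_mul_left, ENNReal.tsum_mul_right, ← hW]
        calc _ ≤ (q.map a) u * 1 := by
              gcongr
              exact ENNReal.mul_inv_le_one _
          _ = _ := mul_one _
    _ = 1 := (q.map a).tsum_coe

lemma log_ineq {s t u w : ℝ} (hs : 0 < s) (ht : 0 < t) (hu : 0 < u) (hw : 0 < w) :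
    -Real.log s + -Real.log w + 1 ≤ -Real.log t + -Real.log u + s⁻¹ * (t * (u * w⁻¹)) := by
  have := Real.log_le_sub_one_of_pos (x := s⁻¹ * (t * (u * w⁻¹))) (by positivity)
  rw [Real.log_mul (by positivity) (by positivity), Real.log_mul (by positivity) (by positivity),
    Real.log_mul (by positivity) (by positivity), Real.log_inv, Real.log_inv] at this
  linarith

lemma neg_log_nonneg {Z : Type*} (q : PMF Z) (z : Z) : 0 ≤ -Real.log (q z).toReal := by
  have := Real.log_nonpos ENNReal.toReal_nonneg (toReal_le_one q z)
  linarith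

lemma ent_submod {Z U V W : Type*} (q : PMF Z) (a : Z → U) (b : Z → V) (c : U → W) (d : V → W)
    (h : ∀ z, c (a z) = d (b z)) (hinj : Function.Injective fun z => (a z, b z)) :
    ent q + ent (q.map (c ∘ a)) ≤ ent (q.map a) + ent (q.map b) := by
  rw [ent_map_eq q a, ent_map_eq q b, ent_map_eq q (c ∘ a), ent_eq q, ← ENNReal.tsum_add,
    ← ENNReal.tsum_add]
  rw [← ENNReal.add_le_add_iff_right ENNReal.one_ne_top]
  refine le_trans ?_ (add_le_add_right (ratio_sum q a b c d h hinj) _)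
  rw [← q.tsum_coe, ← ENNReal.tsum_add, ← ENNReal.tsum_add]
  refine ENNReal.tsum_le_tsum fun z => ?_
  by_cases hz : q z = 0
  · simp [hz]
  have pos : ∀ {T : Type _} (r : PMF T) (x : T), q z ≤ r x → 0 < (r x).toReal := by
    intro T r x hx
    exact ENNReal.toReal_pos (fun h0 => hz (le_antisymm (h0 ▸ hx) zero_le)) (r.apply_ne_top x)
  have p0 : 0 < (q z).toReal := ENNReal.toReal_pos hz (q.apply_ne_top z)
  have p1 := pos (q.map a) (a z) (le_map q a z)
  have p2 : 0 < ((q.map b) (b z)).toReal :=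
    ENNReal.toReal_pos (fun h0 => hz (le_antisymm (h0 ▸ le_map q b z) zero_le))
      ((q.map b).apply_ne_top _)
  have p3 : 0 < ((q.map (c ∘ a)) (c (a z))).toReal :=
    ENNReal.toReal_pos (fun h0 => hz (le_antisymm (h0 ▸ le_map q (c ∘ a) z) zero_le))
      ((q.map (c ∘ a)).apply_ne_top _)
  have key := log_ineq p0 p1 p2 p3
  have n0 := neg_log_nonneg q z
  have n1 := neg_log_nonneg (q.map a) (a z)
  have n2 := neg_log_nonneg (q.map b) (b z)
  have n3 := neg_log_nonneg (q.map (c ∘ a)) (c (a z))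
  have e : (q.map a) (a z) * ((q.map b) (b z) * ((q.map (c ∘ a)) (c (a z)))⁻¹)
      = q z * ENNReal.ofReal ((q z).toReal⁻¹ * (((q.map a) (a z)).toReal *
        (((q.map b) (b z)).toReal * ((q.map (c ∘ a)) (c (a z))).toReal⁻¹))) := by
    rw [ENNReal.ofReal_mul (by positivity), ENNReal.ofReal_mul (by positivity),
      ENNReal.ofReal_mul (by positivity), ENNReal.ofReal_inv_of_pos p0,
      ENNReal.ofReal_inv_of_pos p3, ENNReal.ofReal_toReal (q.apply_ne_top _),
      ENNReal.ofReal_toReal ((q.map a).apply_ne_top _),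
      ENNReal.ofReal_toReal ((q.map b).apply_ne_top _),
      ENNReal.ofReal_toReal ((q.map (c ∘ a)).apply_ne_top _), ← mul_assoc (q z),
      ENNReal.mul_inv_cancel hz (q.apply_ne_top z), one_mul]
  rw [e]
  have k2 := ENNReal.ofReal_le_ofReal key
  rw [ENNReal.ofReal_add (by positivity) (by positivity), ENNReal.ofReal_add n0 n3,
    ENNReal.ofReal_add (by positivity) (by positivity), ENNReal.ofReal_add n1 n2,
    ENNReal.ofReal_one] at k2
  have k3 := mul_le_mul_right k2 (q z)
  simp only [mul_add, mul_one] at k3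
  exact k3

/-! ### Marginals -/

lemma Hm_eq (p : PMF (Fin n → ℕ)) (α : Finset (Fin n)) : Hm p α = (ent (marginal p α)).toReal := by
  unfold Hm ent
  rw [ENNReal.tsum_toReal_eq (fun _ => ENNReal.ofReal_ne_top)]
  exact tsum_congr fun z => (ENNReal.toReal_ofReal (nml_nonneg _ z)).symm

def rst {α β : Finset (Fin n)} (h : α ⊆ β) (x : { i // i ∈ β } → ℕ) : { i // i ∈ α } → ℕ :=
  fun i => x ⟨i.1, h i.2⟩

lemma marginal_map (p : PMF (Fin n → ℕ)) {α β : Finset (Fin n)} (h : α ⊆ β) :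
    (marginal p β).map (rst h) = marginal p α := by
  unfold marginal
  rw [PMF.map_comp]
  rfl

lemma ent_marg_mono (p : PMF (Fin n → ℕ)) {α β : Finset (Fin n)} (h : α ⊆ β) :
    ent (marginal p α) ≤ ent (marginal p β) := by
  rw [← marginal_map p h]; exact ent_mono _ _

lemma ent_marg_submod (p : PMF (Fin n → ℕ)) (α β : Finset (Fin n)) :
    ent (marginal p (α ∪ β)) + ent (marginal p (α ∩ β))
      ≤ ent (marginal p α) + ent (marginal p β) := by
  have := ent_submod (marginal p (α ∪ β)) (rst Finset.subset_union_left)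
    (rst Finset.subset_union_right) (rst (Finset.inter_subset_left (s₂ := β)))
    (rst (Finset.inter_subset_right (s₁ := α))) (fun z => rfl) (by
      intro z z' hz
      simp only [Prod.mk.injEq] at hz
      funext ⟨i, hi⟩
      rcases Finset.mem_union.1 hi with h | h
      · exact congrFun hz.1 ⟨i, h⟩
      · exact congrFun hz.2 ⟨i, h⟩)
  rwa [← PMF.map_comp, marginal_map, marginal_map, marginal_map] at this

lemma ent_ne_top_iff {Z : Type*} (q : PMF Z) :
    ent q ≠ ⊤ ↔ Summable fun z => Real.negMulLog (q z).toReal := by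
  unfold ent
  constructor
  · intro h
    have := ENNReal.summable_toReal h
    refine this.congr fun z => ?_
    exact ENNReal.toReal_ofReal (nml_nonneg _ z)
  · intro h
    exact h.tsum_ofReal_ne_top

lemma ent_fin {Z : Type*} [Finite Z] (q : PMF Z) : ent q ≠ ⊤ := by
  rw [ent_ne_top_iff]
  exact Summable.of_finite

lemma ent_marg_ne_top {p : PMF (Fin n → ℕ)} (hp : FiniteEntropy p) (α : Finset (Fin n)) :
    ent (marginal p α) ≠ ⊤ := by
  induction α using Finset.induction_on with
  | empty => exact ent_fin _
  | insert i s hi ih =>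
    have h1 : ent (marginal p {i}) ≠ ⊤ := by
      have h2 := (ent_ne_top_iff _).2 (hp i)
      have h3 := ent_mono (p.map fun x => x i) (fun v => fun _ : {j // j ∈ ({i} : Finset (Fin n))} => v)
      rw [PMF.map_comp] at h3
      have h4 : marginal p {i} = p.map ((fun v => fun _ : {j // j ∈ ({i} : Finset (Fin n))} => v) ∘
          fun x => x i) := by
        unfold marginal
        congr 1
        funext x ⟨j, hj⟩
        rw [Finset.mem_singleton] at hj
        subst hj
        rfl
      rw [h4]
      exact ne_top_of_le_ne_top h2 h3
    have h5 := ent_marg_submod p {i} s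
    rw [← Finset.insert_eq] at h5
    exact ne_top_of_le_ne_top (ENNReal.add_ne_top.2 ⟨h1, ih⟩) (le_trans le_self_add h5)

/-! ### Polymatroids -/

structure Poly (g : Finset (Fin n) → ℝ) : Prop where
  empty : g ∅ = 0
  mono : ∀ α β, α ⊆ β → g α ≤ g β
  submod : ∀ α β, g (α ∪ β) + g (α ∩ β) ≤ g α + g β

lemma poly_Hc {p : PMF (Fin n → ℕ)} (hp : FiniteEntropy p) (C : Finset (Fin n)) :
    Poly (fun Q => Hc p Q C) := by
  have mono : ∀ α β, α ⊆ β → Hm p α ≤ Hm p β := by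
    intro α β h
    rw [Hm_eq, Hm_eq]
    exact ENNReal.toReal_mono (ent_marg_ne_top hp _) (ent_marg_mono p h)
  refine ⟨by simp [Hc], ?_, ?_⟩
  · intro α β h
    have := mono _ _ (Finset.union_subset_union_left (t := C) h)
    simp only [Hc]; linarith
  · intro α β
    have h := ent_marg_submod p (α ∪ C) (β ∪ C)
    have h := ENNReal.toReal_mono
      (ENNReal.add_ne_top.2 ⟨ent_marg_ne_top hp _, ent_marg_ne_top hp _⟩) h
    rw [ENNReal.toReal_add (ent_marg_ne_top hp _) (ent_marg_ne_top hp _),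
      ENNReal.toReal_add (ent_marg_ne_top hp _) (ent_marg_ne_top hp _)] at h
    simp only [← Hm_eq] at h
    rw [← Finset.union_union_distrib_right, ← Finset.inter_union_distrib_right] at h
    simp only [Hc]; linarith

noncomputable def Df (g : Finset (Fin n) → ℝ) (M : Multiset (Finset (Fin n))) : ℝ :=
  (M.map g).sum - g M.sup

lemma Poly.nonneg {g : Finset (Fin n) → ℝ} (hg : Poly g) (α) : 0 ≤ g α := by
  have := hg.mono ∅ α (by simp)
  rwa [hg.empty] at this

lemma Poly.subadd {g : Finset (Fin n) → ℝ} (hg : Poly g) (α β) : g (α ∪ β) ≤ g α + g β := by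
  have := hg.submod α β
  have := hg.nonneg (α ∩ β)
  linarith

lemma Poly.Df_nonneg {g : Finset (Fin n) → ℝ} (hg : Poly g) (M) : 0 ≤ Df g M := by
  unfold Df
  induction M using Multiset.induction_on with
  | empty => simp [hg.empty]
  | cons A M ih =>
    have := hg.subadd A M.sup
    simp only [Multiset.map_cons, Multiset.sum_cons, Multiset.sup_cons, Finset.sup_eq_union]
    linarith

lemma Poly.Df_two {g : Finset (Fin n) → ℝ} (hg : Poly g) (A B M) :
    g (A ∩ B) ≤ Df g (A ::ₘ B ::ₘ M) := by
  have h1 := hg.Df_nonneg M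
  have h2 := hg.submod A B
  have h3 := hg.subadd (A ∪ B) M.sup
  rw [Finset.union_assoc] at h3
  simp only [Df, Multiset.map_cons, Multiset.sum_cons, Multiset.sup_cons,
    Finset.sup_eq_union] at *
  linarith

lemma Poly.sdiff {g : Finset (Fin n) → ℝ} (hg : Poly g) {I} (hI : g I = 0) (Q) :
    g (Q \ I) = g Q := by
  have h1 := hg.mono (Q \ I) Q Finset.sdiff_subset
  have h2 := hg.subadd (Q \ I) I
  have h3 := hg.mono Q (Q \ I ∪ I) (by simp)
  linarith

lemma Poly.Df_red {g : Finset (Fin n) → ℝ} (hg : Poly g) {I} (hI : g I = 0) (M) :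
    Df g ((M.map fun Q => Q \ I).filter fun Q => Q ≠ ∅) = Df g M := by
  have h : (((M.map fun Q => Q \ I).filter fun Q => Q ≠ ∅).map g).sum = (M.map g).sum ∧
      ((M.map fun Q => Q \ I).filter fun Q => Q ≠ ∅).sup = M.sup \ I := by
    induction M using Multiset.induction_on with
    | empty => simp
    | cons A M ih =>
      simp only [Multiset.map_cons]
      by_cases hA : A \ I = ∅
      · rw [Multiset.filter_cons_of_neg _ (by simpa using hA)]
        refine ⟨?_, ?_⟩
        · rw [ih.1, ← hg.sdiff hI A, hA, hg.empty]; simp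
        · rw [ih.2, Multiset.sup_cons, Finset.sup_eq_union, Finset.union_sdiff_distrib, hA]; simp
      · rw [Multiset.filter_cons_of_pos _ (by simpa using hA)]
        refine ⟨?_, ?_⟩
        · rw [Multiset.map_cons, Multiset.sum_cons, Multiset.sum_cons, ih.1, hg.sdiff hI]
        · rw [Multiset.sup_cons, Multiset.sup_cons, ih.2, Finset.sup_eq_union,
            Finset.sup_eq_union, Finset.union_sdiff_distrib]
  unfold Df
  rw [h.1, h.2, hg.sdiff hI]

lemma two_le {T : Type*} {P : T → Prop} [DecidablePred P] {M : Multiset T}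
    (h : 2 ≤ Multiset.card (M.filter P)) : ∃ A B N, M = A ::ₘ B ::ₘ N ∧ P A ∧ P B := by
  obtain ⟨A, hA⟩ := Multiset.card_pos_iff_exists_mem.1 (by omega : 0 < Multiset.card (M.filter P))
  have hA' := Multiset.mem_filter.1 hA
  obtain ⟨M', rfl⟩ := Multiset.exists_cons_of_mem hA'.1
  rw [Multiset.filter_cons_of_pos _ hA'.2, Multiset.card_cons] at h
  obtain ⟨B, hB⟩ := Multiset.card_pos_iff_exists_mem.1 (by omega : 0 < Multiset.card (M'.filter P))
  have hB' := Multiset.mem_filter.1 hB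
  obtain ⟨N, rfl⟩ := Multiset.exists_cons_of_mem hB'.1
  exact ⟨A, B, N, rfl, hA'.2, hB'.2⟩

lemma Poly.zero_of_sing {g : Finset (Fin n) → ℝ} (hg : Poly g) (I : Finset (Fin n))
    (h : ∀ q ∈ I, g {q} = 0) : g I = 0 := by
  induction I using Finset.induction_on with
  | empty => exact hg.empty
  | insert i s hi ih =>
    have h1 := hg.subadd {i} s
    rw [← Finset.insert_eq, h i (by simp), ih (fun q hq => h q (by simp [hq]))] at h1
    exact le_antisymm (by linarith) (hg.nonneg _)

lemma Poly.rep_zero {g : Finset (Fin n) → ℝ} (hg : Poly g) (K : CMI n) (h : Df g K.Qs = 0) :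
    g (repSet K) = 0 := by
  refine hg.zero_of_sing _ fun q hq => ?_
  simp only [repSet, Finset.mem_filter, Finset.mem_univ, true_and] at hq
  obtain ⟨A, B, N, hM, hA, hB⟩ := two_le hq
  rw [hM] at h
  have h1 := hg.Df_two A B N
  have h2 := hg.mono {q} (A ∩ B) (by simp [hA, hB])
  exact le_antisymm (by linarith) (hg.nonneg _)

lemma Df_card_le_one {g : Finset (Fin n) → ℝ} (hg : Poly g) {M} (h : Multiset.card M ≤ 1) :
    Df g M = 0 := by
  rcases Nat.le_one_iff_eq_zero_or_eq_one.1 h with h | h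
  · rw [Multiset.card_eq_zero.1 h]; simp [Df, hg.empty]
  · obtain ⟨a, rfl⟩ := Multiset.card_eq_one.1 h
    simp [Df]

lemma Poly.Df_parts {g : Finset (Fin n) → ℝ} (hg : Poly g) (K : CMI n) :
    Df g K.Qs = 0 ↔ g (repSet K) = 0 ∧ Df g (parts K) = 0 := by
  constructor
  · intro h
    have h1 := hg.rep_zero K h
    refine ⟨h1, ?_⟩
    unfold parts
    rw [hg.Df_red h1, h]
  · rintro ⟨h1, h2⟩
    unfold parts at h2
    rwa [hg.Df_red h1] at h2

lemma Poly.Df_cons_rep {g : Finset (Fin n) → ℝ} (hg : Poly g) (I M) :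
    Df g (I ::ₘ I ::ₘ M) = 0 ↔ g I = 0 ∧ Df g M = 0 := by
  have key : g I = 0 → Df g (I ::ₘ I ::ₘ M) = Df g M := by
    intro h
    have h1 := hg.mono M.sup (I ∪ M.sup) Finset.subset_union_right
    have h2 := hg.subadd I M.sup
    simp only [Df, Multiset.map_cons, Multiset.sum_cons, Multiset.sup_cons,
      Finset.sup_eq_union, ← Finset.union_assoc, Finset.union_self]
    linarith
  constructor
  · intro h
    have h1 := hg.Df_two I I M
    rw [Finset.inter_self] at h1
    have h2 : g I = 0 := le_antisymm (by linarith) (hg.nonneg _)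
    exact ⟨h2, by rw [← key h2, h]⟩
  · rintro ⟨h1, h2⟩
    rw [key h1, h2]

lemma valid_iff (p : PMF (Fin n → ℕ)) (K : CMI n) :
    Valid p K ↔ Df (fun Q => Hc p Q K.C) K.Qs = 0 := Iff.rfl

lemma valid_pur {p : PMF (Fin n → ℕ)} (hp : FiniteEntropy p) (K : CMI n) :
    Valid p (pur K) ↔ Valid p K := by
  rw [valid_iff, valid_iff]
  have := (poly_Hc hp K.C).Df_red (I := K.C) (by simp [Hc]) K.Qs
  simp only [pur]
  rw [this]

lemma valid_can {p : PMF (Fin n → ℕ)} (hp : FiniteEntropy p) (K : CMI n) :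
    Valid p (can K) ↔ Valid p K := by
  rw [valid_iff, valid_iff]
  have hg := poly_Hc hp K.C
  unfold can
  split_ifs with h1 h2 h3
  · simp only [Df_card_le_one hg h1]
    simp [Df, Hc]
  · rw [hg.Df_parts K, h2]
    simp [hg.empty]
  · rw [hg.Df_parts K, Df_card_le_one hg h3]
    have := hg.Df_cons_rep (repSet K) 0
    have h0 : Df (fun Q => Hc p Q K.C) 0 = 0 := Df_card_le_one hg (by simp)
    rw [h0] at this
    exact this
  · rw [hg.Df_parts K]
    exact hg.Df_cons_rep _ _

/-! ### The one-bit distributions -/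

noncomputable def bit : PMF Bool := PMF.uniformOfFintype Bool

noncomputable def bitD (S : Finset (Fin n)) : PMF (Fin n → ℕ) :=
  bit.map fun b i => if i ∈ S ∧ b = true then 1 else 0

lemma bit_pos : 0 < (ent bit).toReal := by
  refine ENNReal.toReal_pos ?_ (ent_fin _)
  unfold ent bit
  simp only [PMF.uniformOfFintype_apply, Fintype.card_bool, tsum_fintype]
  simp [Real.negMulLog, Real.log_pos]

lemma bitD_fin (S : Finset (Fin n)) : FiniteEntropy (bitD S) := by
  intro i
  rw [← ent_ne_top_iff]
  unfold bitD
  rw [PMF.map_comp]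
  exact ne_top_of_le_ne_top (ent_fin bit) (ent_mono _ _)

lemma bitD_Hm (S α : Finset (Fin n)) :
    Hm (bitD S) α = if (α ∩ S).Nonempty then (ent bit).toReal else 0 := by
  rw [Hm_eq]
  unfold marginal bitD
  rw [PMF.map_comp]
  split_ifs with h
  · obtain ⟨i, hi⟩ := h
    rw [Finset.mem_inter] at hi
    congr 1
    refine le_antisymm (ent_mono _ _) ?_
    have := ent_mono (bit.map ((fun (x : Fin n → ℕ) (i : {i // i ∈ α}) => x i.1) ∘
      fun b i => if i ∈ S ∧ b = true then 1 else 0)) (fun y => decide (y ⟨i, hi.1⟩ = 1))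
    rw [PMF.map_comp] at this
    refine le_trans (le_of_eq ?_) this
    congr 1
    refine (PMF.map_id bit).symm.trans ?_
    congr 1
    funext b
    cases b <;> simp [hi.2]
  · have : ((fun (x : Fin n → ℕ) (i : {i // i ∈ α}) => x i.1) ∘
      fun b i => if i ∈ S ∧ b = true then 1 else 0) = Function.const Bool (fun _ => 0) := by
      funext b ⟨i, hi⟩
      have : i ∉ S := fun h' => h ⟨i, by simp [hi, h']⟩
      simp [this]
    rw [this, PMF.map_const]
    have h0 : ent (PMF.pure (fun _ : {i // i ∈ α} => (0 : ℕ))) = 0 := by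
      unfold ent
      rw [ENNReal.tsum_eq_zero]
      intro z
      rw [PMF.pure_apply]
      split_ifs <;> simp
    rw [h0]; rfl

/-- number of members of `M` meeting `S`. -/
noncomputable def cnt (S : Finset (Fin n)) (M : Multiset (Finset (Fin n))) : ℕ :=
  Multiset.card (M.filter fun Q => (Q ∩ S).Nonempty)

lemma cnt_pos {S A : Finset (Fin n)} (h : (A ∩ S).Nonempty) (M) :
    cnt S (A ::ₘ M) = cnt S M + 1 := by
  unfold cnt
  rw [Multiset.filter_cons_of_pos (p := fun Q => (Q ∩ S).Nonempty) M h, Multiset.card_cons]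

lemma cnt_neg {S A : Finset (Fin n)} (h : ¬ (A ∩ S).Nonempty) (M) :
    cnt S (A ::ₘ M) = cnt S M := by
  unfold cnt
  rw [Multiset.filter_cons_of_neg (p := fun Q => (Q ∩ S).Nonempty) M h]

lemma meets_sing {q : Fin n} {A : Finset (Fin n)} (h : q ∈ A) : (A ∩ {q}).Nonempty :=
  ⟨q, by simp [h]⟩

def VV (K : CMI n) (S : Finset (Fin n)) : Prop := (K.C ∩ S).Nonempty ∨ cnt S K.Qs ≤ 1

lemma valid_bitD (S : Finset (Fin n)) (K : CMI n) : Valid (bitD S) K ↔ VV K S := by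
  unfold Valid J VV
  have hc : ∀ Q, Hc (bitD S) Q K.C =
      if (K.C ∩ S).Nonempty then 0 else if (Q ∩ S).Nonempty then (ent bit).toReal else 0 := by
    intro Q
    unfold Hc
    have e : ((Q ∪ K.C) ∩ S).Nonempty ↔ (Q ∩ S).Nonempty ∨ (K.C ∩ S).Nonempty := by
      rw [Finset.union_inter_distrib_right, Finset.union_nonempty]
    rw [bitD_Hm, bitD_Hm]
    by_cases h1 : (K.C ∩ S).Nonempty <;> by_cases h2 : (Q ∩ S).Nonempty
    · rw [if_pos (e.2 (Or.inr h1)), if_pos h1, if_pos h1, sub_self]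
    · rw [if_pos (e.2 (Or.inr h1)), if_pos h1, if_pos h1, sub_self]
    · rw [if_pos (e.2 (Or.inl h2)), if_neg h1, if_neg h1, if_pos h2, sub_zero]
    · rw [if_neg (fun h => (e.1 h).elim h2 h1), if_neg h1, if_neg h1, if_neg h2, sub_zero]
  simp only [hc]
  by_cases h : (K.C ∩ S).Nonempty
  · simp [h]
  simp only [h, if_false, false_or]
  have : ∀ M : Multiset (Finset (Fin n)),
      (M.map fun Q => if (Q ∩ S).Nonempty then (ent bit).toReal else 0).sum
        = cnt S M * (ent bit).toReal ∧ ((M.sup ∩ S).Nonempty ↔ cnt S M ≠ 0) := by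
    intro M
    induction M using Multiset.induction_on with
    | empty => simp [cnt]
    | cons A M ih =>
      by_cases hA : (A ∩ S).Nonempty
      · rw [cnt_pos hA, Multiset.map_cons, Multiset.sum_cons, ih.1,
          Multiset.sup_cons, Finset.sup_eq_union, Finset.union_inter_distrib_right,
          Finset.union_nonempty]
        simp only [hA, if_true]
        refine ⟨by push_cast; ring, by simp⟩
      · rw [cnt_neg hA, Multiset.map_cons, Multiset.sum_cons, ih.1,
          Multiset.sup_cons, Finset.sup_eq_union, Finset.union_inter_distrib_right,
          Finset.union_nonempty]
        simp only [hA, if_false, false_or]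
        exact ⟨by ring, ih.2⟩
  obtain ⟨h1, h2⟩ := this K.Qs
  rw [h1]
  have hb := bit_pos
  by_cases h0 : cnt S K.Qs = 0
  · have : ¬ (K.Qs.sup ∩ S).Nonempty := by rw [h2]; simpa using h0
    simp [h0, this]
  · rw [if_pos (h2.2 h0)]
    have e : (cnt S K.Qs : ℝ) * (ent bit).toReal - (ent bit).toReal
      = ((cnt S K.Qs : ℝ) - 1) * (ent bit).toReal := by ring
    rw [e, mul_eq_zero, or_iff_left hb.ne', sub_eq_zero]
    norm_cast
    omega

/-! ### Combinatorics -/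

lemma cnt_mono {S T : Finset (Fin n)} (h : S ⊆ T) (M) : cnt S M ≤ cnt T M := by
  unfold cnt
  refine Multiset.card_le_card (Multiset.monotone_filter_right M ?_)
  intro Q hQ
  exact hQ.mono (Finset.inter_subset_inter_left h)

lemma cnt_red {S I : Finset (Fin n)} (h : ∀ i ∈ S, i ∉ I) (M : Multiset (Finset (Fin n))) :
    cnt S ((M.map fun Q => Q \ I).filter fun Q => Q ≠ ∅) = cnt S M := by
  unfold cnt
  rw [Multiset.filter_filter, Multiset.filter_map, Multiset.card_map]
  congr 1
  refine Multiset.filter_congr fun Q _ => ?_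
  have e : (Q \ I) ∩ S = Q ∩ S := by
    ext i
    simp only [Finset.mem_inter, Finset.mem_sdiff]
    constructor
    · tauto
    · rintro ⟨h1, h2⟩; exact ⟨⟨h1, h i h2⟩, h2⟩
  simp only [Function.comp_apply, e]
  constructor
  · exact fun h => h.1
  · intro h'
    refine ⟨h', fun h0 => ?_⟩
    rw [← e, h0] at h'
    simp at h'

lemma cnt_sing (q : Fin n) (M : Multiset (Finset (Fin n))) :
    cnt {q} M = Multiset.card (M.filter fun Q => q ∈ Q) := by
  unfold cnt
  congr 1
  refine Multiset.filter_congr fun Q _ => ?_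
  rw [← Finset.not_disjoint_iff_nonempty_inter, Finset.disjoint_singleton_right, not_not]

lemma mem_rep (K : CMI n) (q : Fin n) : q ∈ repSet K ↔ 2 ≤ cnt {q} K.Qs := by
  rw [cnt_sing]; simp [repSet]

/-- nonempty, pairwise disjoint -/
structure Dis (M : Multiset (Finset (Fin n))) : Prop where
  ne : ∀ P ∈ M, P.Nonempty
  le : ∀ q, cnt {q} M ≤ 1

lemma Dis.eq {M : Multiset (Finset (Fin n))} (h : Dis M) {P Q q} (hP : P ∈ M) (hQ : Q ∈ M)
    (h1 : q ∈ P) (h2 : q ∈ Q) : P = Q := by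
  by_contra hne
  obtain ⟨N, rfl⟩ := Multiset.exists_cons_of_mem hP
  have hQ' : Q ∈ N := by
    rcases Multiset.mem_cons.1 hQ with h | h
    · exact absurd h.symm hne
    · exact h
  obtain ⟨N, rfl⟩ := Multiset.exists_cons_of_mem hQ'
  have := h.le q
  rw [cnt_pos (meets_sing h1), cnt_pos (meets_sing h2)] at this
  omega

lemma Dis.nodup {M : Multiset (Finset (Fin n))} (h : Dis M) : M.Nodup := by
  rw [Multiset.nodup_iff_ne_cons_cons]
  intro P N hM
  obtain ⟨q, hq⟩ := h.ne P (by rw [hM]; simp)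
  have := h.le q
  rw [hM, cnt_pos (meets_sing hq), cnt_pos (meets_sing hq)] at this
  omega

lemma Dis.rel {M : Multiset (Finset (Fin n))} (h : Dis M) (a b : Fin n) :
    2 ≤ cnt {a, b} M ↔ ∃ P ∈ M, ∃ Q ∈ M, P ≠ Q ∧ a ∈ P ∧ b ∈ Q := by
  have m : ∀ P : Finset (Fin n), (P ∩ {a, b}).Nonempty ↔ a ∈ P ∨ b ∈ P := by
    intro P
    constructor
    · rintro ⟨x, hx⟩
      simp only [Finset.mem_inter, Finset.mem_insert, Finset.mem_singleton] at hx
      rcases hx with ⟨hx, rfl | rfl⟩ <;> simp [hx]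
    · rintro (h | h)
      · exact ⟨a, by simp [h]⟩
      · exact ⟨b, by simp [h]⟩
  constructor
  · intro h2
    obtain ⟨A, B, N, hM, hA, hB⟩ := two_le h2
    have nd := h.nodup
    have hAB : A ≠ B := by
      rintro rfl
      exact Multiset.nodup_iff_ne_cons_cons.1 nd A N hM
    have mA : A ∈ M := by rw [hM]; simp
    have mB : B ∈ M := by rw [hM]; simp
    rw [m] at hA hB
    rcases hA with hA | hA <;> rcases hB with hB | hB
    · exact absurd (h.eq mA mB hA hB) hAB
    · exact ⟨A, mA, B, mB, hAB, hA, hB⟩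
    · exact ⟨B, mB, A, mA, hAB.symm, hB, hA⟩
    · exact absurd (h.eq mA mB hA hB) hAB
  · rintro ⟨P, hP, Q, hQ, hne, ha, hb⟩
    obtain ⟨N, rfl⟩ := Multiset.exists_cons_of_mem hP
    have hQ' : Q ∈ N := by
      rcases Multiset.mem_cons.1 hQ with h | h
      · exact absurd h.symm hne
      · exact h
    obtain ⟨N, rfl⟩ := Multiset.exists_cons_of_mem hQ'
    rw [cnt_pos ((m P).2 (Or.inl ha)), cnt_pos ((m Q).2 (Or.inr hb))]
    omega

lemma Dis.exists_rel {M : Multiset (Finset (Fin n))} (h : Dis M) (hc : 2 ≤ Multiset.card M) :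
    ∃ a b, 2 ≤ cnt {a, b} M := by
  have : 2 ≤ Multiset.card (M.filter fun _ => True) := by simpa using hc
  obtain ⟨A, B, N, hM, -, -⟩ := two_le this
  have hAB : A ≠ B := by
    rintro rfl
    exact Multiset.nodup_iff_ne_cons_cons.1 h.nodup A N hM
  have mA : A ∈ M := by rw [hM]; simp
  have mB : B ∈ M := by rw [hM]; simp
  obtain ⟨a, ha⟩ := h.ne A mA
  obtain ⟨b, hb⟩ := h.ne B mB
  exact ⟨a, b, (h.rel a b).2 ⟨A, mA, B, mB, hAB, ha, hb⟩⟩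

lemma cnt_le_card (S : Finset (Fin n)) (M) : cnt S M ≤ Multiset.card M :=
  Multiset.card_le_card (Multiset.filter_le _ _)

lemma Dis.subset {M M' : Multiset (Finset (Fin n))} (h : Dis M) (h' : Dis M')
    (hR : ∀ a b, 2 ≤ cnt {a, b} M ↔ 2 ≤ cnt {a, b} M') (hc : 2 ≤ Multiset.card M) :
    ∀ P ∈ M, P ∈ M' := by
  simp only [h.rel, h'.rel] at hR
  intro P hP
  obtain ⟨N, rfl⟩ := Multiset.exists_cons_of_mem hP
  obtain ⟨Q, hQ⟩ := Multiset.card_pos_iff_exists_mem.1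
    (by simp at hc; omega : 0 < Multiset.card N)
  have hPQ : P ≠ Q := by
    rintro rfl
    exact (Multiset.nodup_cons.1 h.nodup).1 hQ
  have hQ : Q ∈ P ::ₘ N := by simp [hQ]
  obtain ⟨a, ha⟩ := h.ne P hP
  obtain ⟨b, hb⟩ := h.ne Q hQ
  obtain ⟨P', hP', Q', hQ', hne', ha', hb'⟩ := (hR a b).1 ⟨P, hP, Q, hQ, hPQ, ha, hb⟩
  have : P = P' := by
    ext x
    constructor
    · intro hx
      obtain ⟨P2, hP2, -, -, -, hx2, -⟩ := (hR x b).1 ⟨P, hP, Q, hQ, hPQ, hx, hb⟩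
      by_cases e : P2 = P'
      · exact e ▸ hx2
      · obtain ⟨A, hA, B, hB, hAB, h1, h2⟩ := (hR x a).2 ⟨P2, hP2, P', hP', e, hx2, ha'⟩
        exact absurd ((h.eq hA hP h1 hx).trans (h.eq hB hP h2 ha).symm) hAB
    · intro hx
      obtain ⟨P2, hP2, -, -, -, hx2, -⟩ := (hR x b).2 ⟨P', hP', Q', hQ', hne', hx, hb'⟩
      by_cases e : P2 = P
      · exact e ▸ hx2
      · obtain ⟨A, hA, B, hB, hAB, h1, h2⟩ := (hR x a).1 ⟨P2, hP2, P, hP, e, hx2, ha⟩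
        exact absurd ((h'.eq hA hP' h1 hx).trans (h'.eq hB hP' h2 ha').symm) hAB
  rw [this]; exact hP'

lemma Dis.two_iff {M M' : Multiset (Finset (Fin n))} (h : Dis M)
    (hR : ∀ a b, 2 ≤ cnt {a, b} M ↔ 2 ≤ cnt {a, b} M') (hc : 2 ≤ Multiset.card M) :
    2 ≤ Multiset.card M' := by
  obtain ⟨a, b, hab⟩ := h.exists_rel hc
  exact le_trans ((hR a b).1 hab) (cnt_le_card _ _)

lemma Dis.unique {M M' : Multiset (Finset (Fin n))} (h : Dis M) (h' : Dis M')
    (hR : ∀ a b, 2 ≤ cnt {a, b} M ↔ 2 ≤ cnt {a, b} M') (hc : 2 ≤ Multiset.card M) :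
    M = M' := by
  have hc' := h.two_iff hR hc
  refine (Multiset.Nodup.ext h.nodup h'.nodup).2 fun P => ⟨h.subset h' hR hc P, ?_⟩
  exact h'.subset h (fun a b => (hR a b).symm) hc' P

lemma cnt_parts_zero {S} (K : CMI n) {i} (hi : i ∈ repSet K) (hS : S = {i}) :
    cnt S (parts K) = 0 := by
  subst hS
  rw [cnt_sing, Multiset.card_eq_zero, Multiset.filter_eq_nil]
  intro P hP
  unfold parts at hP
  rw [Multiset.mem_filter, Multiset.mem_map] at hP
  obtain ⟨⟨Q, -, rfl⟩, -⟩ := hP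
  simp [hi]

lemma parts_dis (K : CMI n) : Dis (parts K) := by
  constructor
  · intro P hP
    exact Finset.nonempty_iff_ne_empty.2 (Multiset.mem_filter.1 hP).2
  · intro q
    by_cases hq : q ∈ repSet K
    · rw [cnt_parts_zero K hq rfl]; omega
    · unfold parts
      rw [cnt_red (by simpa using hq)]
      rw [mem_rep] at hq
      omega

lemma pur_pure (K : CMI n) : IsPure (pur K) := by
  intro Q hQ
  simp only [pur, Multiset.mem_filter, Multiset.mem_map] at hQ
  obtain ⟨⟨R, -, rfl⟩, h⟩ := hQ
  exact ⟨h, by simp [pur]⟩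

lemma IsPure.sing_C {K : CMI n} (hK : IsPure K) {q} (hq : q ∈ K.C) : cnt {q} K.Qs = 0 := by
  rw [cnt_sing, Multiset.card_eq_zero, Multiset.filter_eq_nil]
  intro Q hQ h
  have := (hK Q hQ).2
  have : q ∈ Q ∩ K.C := by simp [h, hq]
  simp_all

lemma rep_iff {K : CMI n} (hK : IsPure K) (q) : q ∈ repSet K ↔ ¬ VV K {q} := by
  rw [mem_rep]
  unfold VV
  have e : (K.C ∩ {q}).Nonempty ↔ q ∈ K.C := by
    rw [← Finset.not_disjoint_iff_nonempty_inter, Finset.disjoint_singleton_right, not_not]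
  rw [e]
  have := @IsPure.sing_C n K hK q
  constructor
  · rintro h (h' | h')
    · have := this h'; omega
    · omega
  · intro h
    push Not at h
    omega

/-- the conditioning set is detected by any violated set -/
lemma C_iff {K : CMI n} {S} (hS : ¬ VV K S) (c) : c ∈ K.C ↔ VV K (insert c S) := by
  unfold VV at *
  push Not at hS
  constructor
  · intro h; exact Or.inl ⟨c, by simp [h]⟩
  · rintro (⟨x, hx⟩ | h)
    · simp only [Finset.mem_inter, Finset.mem_insert] at hx
      rcases hx with ⟨h1, rfl | h2⟩
      · exact h1
      · have : x ∈ K.C ∩ S := by simp [h1, h2]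
        simp_all
    · have := cnt_mono (Finset.subset_insert c S) K.Qs
      omega

lemma pair_iff {K : CMI n} (hK : IsPure K) {a b} (ha : a ∉ repSet K) (hb : b ∉ repSet K) :
    ¬ VV K {a, b} ↔ 2 ≤ cnt {a, b} (parts K) := by
  have e : cnt {a, b} (parts K) = cnt {a, b} K.Qs := by
    unfold parts
    refine cnt_red ?_ _
    intro i hi
    simp only [Finset.mem_insert, Finset.mem_singleton] at hi
    rcases hi with rfl | rfl <;> assumption
  constructor
  · intro h
    unfold VV at h
    push Not at h
    omega
  · rintro h (⟨x, hx⟩ | h')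
    · rw [(parts_dis K).rel] at h
      obtain ⟨P, hP, Q, hQ, -, h1, h2⟩ := h
      have key : ∀ P ∈ parts K, x ∉ P := by
        intro P hP hxP
        unfold parts at hP
        rw [Multiset.mem_filter, Multiset.mem_map] at hP
        obtain ⟨⟨R, hR, rfl⟩, -⟩ := hP
        have h3 := (hK R hR).2
        have : x ∈ R ∩ K.C := by
          simp only [Finset.mem_inter, Finset.mem_sdiff] at hx hxP ⊢
          exact ⟨hxP.1, hx.1⟩
        simp_all
      simp only [Finset.mem_inter, Finset.mem_insert, Finset.mem_singleton] at hx
      rcases hx with ⟨-, rfl | rfl⟩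
      · exact key P hP h1
      · exact key Q hQ h2
    · omega

lemma pair_false {K : CMI n} {a b} (h : a ∈ repSet K ∨ b ∈ repSet K) :
    ¬ 2 ≤ cnt {a, b} (parts K) := by
  rw [(parts_dis K).rel]
  rintro ⟨P, hP, Q, hQ, -, h1, h2⟩
  have key : ∀ P ∈ parts K, ∀ x ∈ P, x ∉ repSet K := by
    intro P hP x hxP
    unfold parts at hP
    rw [Multiset.mem_filter, Multiset.mem_map] at hP
    obtain ⟨⟨R, hR, rfl⟩, -⟩ := hP
    exact (Finset.mem_sdiff.1 hxP).2
  rcases h with h | h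
  · exact key P hP a h1 h
  · exact key Q hQ b h2 h

lemma parts_of_rep_empty {K : CMI n} (hK : IsPure K) (h : repSet K = ∅) : parts K = K.Qs := by
  unfold parts
  rw [h]
  simp only [Finset.sdiff_empty, Multiset.map_id']
  exact Multiset.filter_eq_self.2 fun Q hQ => (hK Q hQ).1

lemma card_of_rep {K : CMI n} {q} (h : q ∈ repSet K) : 2 ≤ Multiset.card K.Qs := by
  rw [mem_rep] at h
  exact le_trans h (cnt_le_card _ _)

lemma can_eq {K K' : CMI n} (hK : IsPure K) (hK' : IsPure K') (h : ∀ S, VV K S ↔ VV K' S) :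
    can K = can K' := by
  have hI : repSet K = repSet K' := by
    ext q
    rw [rep_iff hK, rep_iff hK', h]
  have hR : ∀ a b, 2 ≤ cnt {a, b} (parts K) ↔ 2 ≤ cnt {a, b} (parts K') := by
    intro a b
    by_cases hab : a ∈ repSet K ∨ b ∈ repSet K
    · have h1 := pair_false hab
      rw [hI] at hab
      have h2 := pair_false hab
      tauto
    · push Not at hab
      rw [← pair_iff hK hab.1 hab.2, h]
      rw [hI] at hab
      rw [← pair_iff hK' hab.1 hab.2]
  have hC : ∀ S, ¬ VV K S → K.C = K'.C := by
    intro S hS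
    ext c
    rw [C_iff hS, C_iff (fun h' => hS ((h S).2 h')), h]
  have hR' := fun a b => (hR a b).symm
  by_cases hE : repSet K = ∅
  · have hE' : repSet K' = ∅ := hI ▸ hE
    have e := parts_of_rep_empty hK hE
    have e' := parts_of_rep_empty hK' hE'
    unfold can
    by_cases hc : 2 ≤ Multiset.card (parts K)
    · have hc' := (parts_dis K).two_iff hR hc
      obtain ⟨a, b, hab⟩ := (parts_dis K).exists_rel hc
      rw [← pair_iff hK (by simp [hE]) (by simp [hE])] at hab
      rw [if_neg (by rw [← e]; omega), if_pos hE, if_neg (by rw [← e']; omega), if_pos hE',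
        hC _ hab, (parts_dis K).unique (parts_dis K') hR hc]
    · have hc' : ¬ 2 ≤ Multiset.card (parts K') := fun hc' => hc ((parts_dis K').two_iff hR' hc')
      rw [if_pos (by rw [← e]; omega), if_pos (by rw [← e']; omega)]
  · have hE' : ¬ repSet K' = ∅ := hI ▸ hE
    obtain ⟨q, hq⟩ := Finset.nonempty_iff_ne_empty.2 hE
    have k := card_of_rep hq
    have k' := card_of_rep (hI ▸ hq)
    have c := hC _ ((rep_iff hK q).1 hq)
    unfold can
    rw [if_neg (by omega), if_neg hE, if_neg (by omega : ¬ Multiset.card K'.Qs ≤ 1), if_neg hE']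
    by_cases hc : 2 ≤ Multiset.card (parts K)
    · have hc' := (parts_dis K).two_iff hR hc
      rw [if_neg (by omega), if_neg (by omega), c, hI,
        (parts_dis K).unique (parts_dis K') hR hc]
    · have hc' : ¬ 2 ≤ Multiset.card (parts K') := fun hc' => hc ((parts_dis K').two_iff hR' hc')
      rw [if_pos (by omega), if_pos (by omega), c, hI]

/-- for arbitrary CMIs, `K ∼ K'` iff `can(pur(K)) = can(pur(K'))`
(all degenerate canonical forms being represented by `⟨∅, 0⟩`). -/
theorem stmt10 {n : ℕ} (K K' : CMI n) :
    Equivalent K K' ↔ can (pur K) = can (pur K') := by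
  constructor
  · intro h
    refine can_eq (pur_pure K) (pur_pure K') fun S => ?_
    have hf := bitD_fin S
    rw [← valid_bitD, ← valid_bitD, valid_pur hf, valid_pur hf]
    exact h _ hf
  · intro h p hp
    rw [← valid_pur hp K, ← valid_pur hp K', ← valid_can hp (pur K), ← valid_can hp (pur K'), h]

end Paper
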